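/- arXiv:1708.03780 — 2 statements merged into one kernel-verified Lean document; each statement's English description precedes it below -/
import Mathlib

section
/- Let F be a piecewise translation of m = d+1 branches in ℝ^d whose translation vectors have rank d, and assume the torus rotation R : T → T, R(φ) = φ + π(v_0), is ergodic with respect to Haar measure on T = ℝ^d/L. Then F is of finite type: there exists n ∈ ℕ with Ω_{n+1} = Ω_n. -/
open MeasureTheory Topology Filter Set

/-- A piecewise translation map (PWT) of `m` branches in `ℝ^d`: a region `Ω`
partitioned into regions `P 0, …, P (m-1)` with null boundaries and pairwise disjoint
interiors, together with translation vectors `v i` such that `P i + v i ⊆ Ω`, and a fixed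
measurable resolution `idx` of the ambiguity on overlapping boundaries. -/
structure PWT (d m : ℕ) where
  Om : Set (Fin d → ℝ)
  P : Fin m → Set (Fin d → ℝ)
  v : Fin m → (Fin d → ℝ)
  idx : (Fin d → ℝ) → Fin m
  compact_Om : IsCompact Om
  region_Om : Om = closure (interior Om)
  compact_P : ∀ i, IsCompact (P i)
  region_P : ∀ i, P i = closure (interior (P i))
  union_P : Om = ⋃ i, P i
  disj_P : ∀ i j, i ≠ j → interior (P i) ∩ interior (P j) = ∅
  null_bd_P : ∀ i, volume (frontier (P i)) = 0
  translate_mem : ∀ i, ∀ x ∈ P i, x + v i ∈ Om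
  idx_mem : ∀ x ∈ Om, x ∈ P (idx x)
  idx_meas : Measurable idx

namespace PWT

variable {d m : ℕ}

/-- The piecewise translation map `F(x) = x + v_{i(x)}`. -/
def F (T : PWT d m) (x : Fin d → ℝ) : Fin d → ℝ := x + T.v (T.idx x)

/-- `Ω_0 = Ω`, `Ω_{n+1} = closure (F(Ω_n))`. -/
def OmSeq (T : PWT d m) : ℕ → Set (Fin d → ℝ)
  | 0 => T.Om
  | n + 1 => closure (T.F '' T.OmSeq n)

/-- The attractor `A = ⋂ₙ Ω_n`. -/
def attractor (T : PWT d m) : Set (Fin d → ℝ) := ⋂ n, T.OmSeq n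

/-- The fate map `𝓕(x) = (i(x), i(F x), i(F² x), …)`. -/
def fate (T : PWT d m) (x : Fin d → ℝ) : ℕ → Fin m := fun n => T.idx (T.F^[n] x)

/-- The matrix whose columns are the lattice generators `v_1 - v_0, …, v_d - v_0`. -/
noncomputable def latMatrix (T : PWT d (d + 1)) : Matrix (Fin d) (Fin d) ℝ :=
  Matrix.of fun i j => (T.v j.succ - T.v 0) i

/-- The canonical projection `π : ℝ^d → T = ℝ^d/L ≅ (ℝ/ℤ)^d`, expressed in the
coordinates given by the lattice basis `v_1 - v_0, …, v_d - v_0` of `L`. -/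
noncomputable def torusProj (T : PWT d (d + 1)) (x : Fin d → ℝ) : Fin d → AddCircle (1 : ℝ) :=
  fun i => ((T.latMatrix⁻¹.mulVec x) i : AddCircle (1 : ℝ))

end PWT

namespace PWT

section

variable {d m : ℕ} (T : PWT d m)

lemma eq_of_mem_interior {x : Fin d → ℝ} {i j : Fin m} (hi : x ∈ interior (T.P i))
    (hj : x ∈ T.P j) : j = i := by
  by_contra hne
  rw [T.region_P j] at hj
  obtain ⟨y, hyi, hyj⟩ := mem_closure_iff.1 hj _ isOpen_interior hi
  exact (Set.ext_iff.1 (T.disj_P j i hne) y).1 ⟨hyj, hyi⟩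

lemma P_subset_Om (i : Fin m) : T.P i ⊆ T.Om := by
  rw [T.union_P]
  exact subset_iUnion _ i

/-- Away from the boundaries of the pieces, membership in the region and the branch
index are locally constant. -/
lemma eventually_mem_and_idx {x : Fin d → ℝ} (hx : ∀ i, x ∉ frontier (T.P i)) :
    ∀ᶠ y in 𝓝 x, (y ∈ T.Om ↔ x ∈ T.Om) ∧ (x ∈ T.Om → T.idx y = T.idx x) := by
  by_cases hxO : x ∈ T.Om
  · have hxi : x ∈ interior (T.P (T.idx x)) := by
      by_contra h
      exact hx (T.idx x) ⟨subset_closure (T.idx_mem x hxO), h⟩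
    filter_upwards [isOpen_interior.mem_nhds hxi] with y hy
    have hyO : y ∈ T.Om := T.P_subset_Om _ (interior_subset hy)
    exact ⟨iff_of_true hyO hxO, fun _ => T.eq_of_mem_interior hy (T.idx_mem y hyO)⟩
  · filter_upwards [T.compact_Om.isClosed.isOpen_compl.mem_nhds hxO] with y hy
    exact ⟨iff_of_false hy hxO, fun h => absurd h hxO⟩

lemma F_mem_Om {x : Fin d → ℝ} (hx : x ∈ T.Om) : T.F x ∈ T.Om :=
  T.translate_mem _ x (T.idx_mem x hx)

lemma isClosed_OmSeq (n : ℕ) : IsClosed (T.OmSeq n) := by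
  cases n with
  | zero => exact T.compact_Om.isClosed
  | succ n => exact isClosed_closure

lemma OmSeq_antitone : Antitone T.OmSeq := by
  refine antitone_nat_of_succ_le fun n => ?_
  induction n with
  | zero =>
    refine closure_minimal ?_ T.compact_Om.isClosed
    rintro _ ⟨x, hx, rfl⟩
    exact T.F_mem_Om hx
  | succ n ih => exact closure_mono (image_mono ih)

lemma iterate_mem_OmSeq {x : Fin d → ℝ} (hx : x ∈ T.Om) (n : ℕ) : T.F^[n] x ∈ T.OmSeq n := by
  induction n with
  | zero => exact hx
  | succ n ih =>
    rw [Function.iterate_succ_apply']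
    exact subset_closure ⟨_, ih, rfl⟩

variable (L : AddSubgroup (Fin d → ℝ)) (v : Fin d → ℝ)

/-- The points of the region lying in the same `L`-coset as `x`. -/
def fiber (x : Fin d → ℝ) : Set (Fin d → ℝ) := {y | y ∈ T.Om ∧ y - x ∈ L}

/-- The points whose forward orbit under `x ↦ x + v` avoids, modulo `L`, all boundaries of
the pieces. -/
def Generic (x : Fin d → ℝ) : Prop :=
  ∀ (j : ℕ) (l : L) (i : Fin m), x + (j • v + l) ∉ frontier (T.P i)

variable {L v}

lemma finite_coset_inter
    (hfin : ∀ s : Set (Fin d → ℝ), Bornology.IsBounded s → (s ∩ (L : Set (Fin d → ℝ))).Finite)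
    {s : Set (Fin d → ℝ)} (hs : Bornology.IsBounded s) (x : Fin d → ℝ) :
    {y | y ∈ s ∧ y - x ∈ L}.Finite := by
  refine Set.Finite.of_finite_image (f := fun y => y - x)
    ((hfin ((fun y => y - x) '' s) ?_).subset ?_) (sub_left_injective.injOn)
  · exact (IsometryEquiv.subRight x).isometry.lipschitz.isBounded_image hs
  · rintro _ ⟨y, ⟨hy, hyL⟩, rfl⟩
    exact ⟨⟨y, hy, rfl⟩, hyL⟩

lemma ae_generic [Countable L] (c : Fin d → ℝ) : ∀ᵐ x, T.Generic L v (c + x) := by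
  simp only [Generic, ae_all_iff]
  intro j l i
  have h : ∀ᵐ x, x ∉ frontier (T.P i) := measure_eq_zero_iff_ae_notMem.1 (T.null_bd_P i)
  have hmp := measurePreserving_add_right volume (c + (j • v + (l : Fin d → ℝ)))
  filter_upwards [hmp.quasiMeasurePreserving.ae h] with x hx
  convert hx using 2
  abel

lemma F_sub_mem (hv : ∀ i, T.v i - v ∈ L) (x : Fin d → ℝ) : T.F x - (x + v) ∈ L := by
  convert hv (T.idx x) using 1
  simp only [F]
  abel

lemma iterate_sub_mem (hv : ∀ i, T.v i - v ∈ L) (x : Fin d → ℝ) (n : ℕ) :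
    T.F^[n] x - (x + n • v) ∈ L := by
  induction n with
  | zero => simp
  | succ n ih =>
    rw [Function.iterate_succ_apply']
    convert L.add_mem ih (T.F_sub_mem hv (T.F^[n] x)) using 1
    rw [succ_nsmul]
    abel

lemma iterate_mem_Om {x : Fin d → ℝ} (hx : x ∈ T.Om) (n : ℕ) : T.F^[n] x ∈ T.Om :=
  T.OmSeq_antitone (Nat.zero_le n) (T.iterate_mem_OmSeq hx n)

lemma Generic.iterate_notMem_frontier {T : PWT d m} {x y : Fin d → ℝ} (hx : T.Generic L v x)
    (hv : ∀ i, T.v i - v ∈ L) (hy : y - x ∈ L) (n : ℕ) (i : Fin m) :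
    T.F^[n] y ∉ frontier (T.P i) := by
  have := hx n ⟨_, L.add_mem hy (T.iterate_sub_mem hv y n)⟩ i
  convert this using 2
  simp only
  abel

lemma tendsto_add_left_nhds (x : Fin d → ℝ) : Tendsto (fun h => x + h) (𝓝 0) (𝓝 x) := by
  have : Continuous fun h : Fin d → ℝ => x + h := by fun_prop
  simpa using this.tendsto 0

lemma Generic.eventually_iterate_add {T : PWT d m} {x y : Fin d → ℝ} (hx : T.Generic L v x)
    (hv : ∀ i, T.v i - v ∈ L) (hy : y ∈ T.fiber L x) (n : ℕ) :
    ∀ᶠ h in 𝓝 0, T.F^[n] (y + h) = T.F^[n] y + h := by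
  induction n with
  | zero => simp
  | succ n ih =>
    filter_upwards [ih, (tendsto_add_left_nhds (T.F^[n] y)).eventually
      (T.eventually_mem_and_idx (hx.iterate_notMem_frontier hv hy.2 n))] with h h1 h2
    rw [Function.iterate_succ_apply', h1, Function.iterate_succ_apply', F,
      h2.2 (T.iterate_mem_Om hy.1 n), F]
    abel

lemma Generic.eventually_fiber_add {T : PWT d m} {x : Fin d → ℝ} (hx : T.Generic L v x)
    (hfin : ∀ s : Set (Fin d → ℝ), Bornology.IsBounded s → (s ∩ (L : Set (Fin d → ℝ))).Finite) :
    ∀ᶠ h in 𝓝 0, ∀ y, y - (x + h) ∈ L → y ∈ T.Om → y - h ∈ T.fiber L x := by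
  have hb : Bornology.IsBounded (Metric.thickening 1 T.Om) := T.compact_Om.isBounded.thickening
  have hS := finite_coset_inter hfin hb x
  have key : ∀ᶠ h in 𝓝 0, ∀ z ∈ {y | y ∈ Metric.thickening 1 T.Om ∧ y - x ∈ L},
      (z + h ∈ T.Om ↔ z ∈ T.Om) := by
    rw [hS.eventually_all]
    rintro z ⟨-, hz⟩
    refine ((tendsto_add_left_nhds z).eventually (T.eventually_mem_and_idx fun i => ?_)).mono
      fun h hh => hh.1
    convert hx 0 ⟨_, hz⟩ i using 2
    simp
  filter_upwards [key, Metric.ball_mem_nhds (0 : Fin d → ℝ) one_pos] with h h1 h2 y hyL hy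
  have hL : y - h - x ∈ L := by
    convert hyL using 1
    abel
  refine ⟨(h1 (y - h) ⟨?_, hL⟩).1 (by simpa using hy), hL⟩
  exact Metric.mem_thickening_iff.2 ⟨y, hy, by simpa [dist_eq_norm] using h2⟩

/-- If the local behaviour of orbits is constant on a ball around `x`, then the set
`OmSeq n` over the corresponding translated ball consists of translates of the image of the
fiber. -/
lemma OmSeq_sub_mem {x : Fin d → ℝ} {r : ℝ} {N : ℕ} (hv : ∀ i, T.v i - v ∈ L)
    (hfib : ∀ h ∈ Metric.ball 0 r, ∀ y, y - (x + h) ∈ L → y ∈ T.Om → y - h ∈ T.fiber L x)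
    (hit : ∀ h ∈ Metric.ball 0 r, ∀ n ≤ N, ∀ y ∈ T.fiber L x, T.F^[n] (y + h) = T.F^[n] y + h)
    {n : ℕ} (hn : n ≤ N) {h : Fin d → ℝ} (hh : h ∈ Metric.ball 0 r) {z : Fin d → ℝ}
    (hz : z ∈ T.OmSeq n) (hzL : z - (x + n • v + h) ∈ L) :
    z - h ∈ T.F^[n] '' T.fiber L x := by
  induction n generalizing h z with
  | zero => simpa using hfib h hh z (by simpa using hzL) hz
  | succ n ih =>
    have hopen : IsOpen {z' | h + (z' - z) ∈ Metric.ball (0 : Fin d → ℝ) r} :=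
      Metric.isOpen_ball.preimage (by fun_prop)
    obtain ⟨_, hball, y, hy, rfl⟩ := mem_closure_iff.1 hz _ hopen (by simpa using hh)
    have hball : h + (T.F y - z) ∈ Metric.ball (0 : Fin d → ℝ) r := hball
    have hyL : y - (x + n • v + (h + (T.F y - z))) ∈ L := by
      convert L.sub_mem hzL (T.F_sub_mem hv y) using 1
      rw [succ_nsmul]
      abel
    obtain ⟨u, hu, hue⟩ := ih (by lia) hball hy hyL
    have hy' : y = T.F^[n] (u + (h + (T.F y - z))) := by
      rw [hit _ hball n (by lia) u hu, hue]
      abel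
    refine ⟨u, hu, ?_⟩
    have h1 := hit _ hball (n + 1) hn u hu
    rw [Function.iterate_succ_apply' _ _ (u + _), ← hy'] at h1
    rw [← sub_eq_iff_eq_add] at h1
    rw [← h1]
    abel

/-- Stabilisation over an open set propagates along the dynamics. -/
lemma OmSeq_inter_subset_succ {O O' : Set (Fin d → ℝ)} (hO' : IsOpen O')
    (hF : ∀ y, T.F y ∈ O' → y ∈ O) {n : ℕ} (h : T.OmSeq n ∩ O ⊆ T.OmSeq (n + 1)) :
    T.OmSeq (n + 1) ∩ O' ⊆ T.OmSeq (n + 2) := by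
  rintro z ⟨hz, hzO⟩
  refine mem_closure_iff.2 fun V hV hzV => ?_
  obtain ⟨_, ⟨h1, h2⟩, y, hy, rfl⟩ := mem_closure_iff.1 hz _ (hV.inter hO') ⟨hzV, hzO⟩
  exact ⟨T.F y, h1, y, h ⟨hy, hF y h2⟩, rfl⟩

/-- There is an open ball over which the sets `OmSeq n` do not depend on `n ≥ N`. -/
lemma exists_ball_OmSeq_subset [Countable L]
    (hfin : ∀ s : Set (Fin d → ℝ), Bornology.IsBounded s → (s ∩ (L : Set (Fin d → ℝ))).Finite)
    (hv : ∀ i, T.v i - v ∈ L) :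
    ∃ (N : ℕ) (c : Fin d → ℝ) (r : ℝ), 0 < r ∧ ∀ n, N ≤ n →
      T.OmSeq N ∩ {z | ∃ l ∈ L, z - l ∈ Metric.ball c r} ⊆ T.OmSeq n := by
  have hff : ∀ x, (T.fiber L x).Finite := finite_coset_inter hfin T.compact_Om.isBounded
  obtain ⟨a, ha⟩ : ∃ a, T.Generic L v a := by
    obtain ⟨a, ha⟩ := (T.ae_generic (L := L) (v := v) 0).exists
    exact ⟨_, ha⟩
  obtain ⟨⟨x, N⟩, hx, hmin⟩ := exists_minimalFor_of_wellFoundedLT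
    (fun p : (Fin d → ℝ) × ℕ => T.Generic L v p.1)
    (fun p => (T.F^[p.2] '' T.fiber L p.1).ncard) ⟨(a, 0), ha⟩
  replace hmin : ∀ y n, T.Generic L v y →
      (T.F^[N] '' T.fiber L x).ncard ≤ (T.F^[n] '' T.fiber L y).ncard := fun y n hy => by
    by_contra! hlt
    exact absurd (hmin (j := (y, n)) hy hlt.le) (not_le.2 hlt)
  replace hx : T.Generic L v x := hx
  have hit : ∀ᶠ h in 𝓝 0, ∀ n ∈ Set.Iic N, ∀ y ∈ T.fiber L x,
      T.F^[n] (y + h) = T.F^[n] y + h := by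
    rw [(Set.finite_Iic N).eventually_all]
    intro n _
    rw [(hff x).eventually_all]
    exact fun y hy => hx.eventually_iterate_add hv hy n
  obtain ⟨r, hr, hball⟩ := Metric.eventually_nhds_iff_ball.1 ((hx.eventually_fiber_add hfin).and hit)
  refine ⟨N, x + N • v, r, hr, fun n hn => ?_⟩
  rintro z ⟨hz, l, hl, hzl⟩
  have hsheet : ∀ h ∈ Metric.ball 0 r, ∀ z ∈ T.OmSeq N, z - (x + N • v + h) ∈ L →
      z - h ∈ T.F^[N] '' T.fiber L x := fun h hh z hz hzL =>
    T.OmSeq_sub_mem hv (fun h hh => (hball h hh).1)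
      (fun h hh n hn => (hball h hh).2 n hn) le_rfl hh hz hzL
  have hgen : ∀ h ∈ Metric.ball 0 r, T.Generic L v (x + N • v - n • v + h) →
      ∀ u ∈ T.F^[N] '' T.fiber L x, u + h ∈ T.OmSeq n := by
    intro h hh hg u hu
    have hsub : T.F^[n] '' T.fiber L (x + N • v - n • v + h) ⊆
        (fun u => u + h) '' (T.F^[N] '' T.fiber L x) := by
      rintro _ ⟨y, hy, rfl⟩
      refine ⟨T.F^[n] y - h, hsheet h hh _ (T.OmSeq_antitone hn (T.iterate_mem_OmSeq hy.1 n)) ?_,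
        sub_add_cancel _ _⟩
      convert L.add_mem hy.2 (T.iterate_sub_mem hv y n) using 1
      abel
    have heq := Set.eq_of_subset_of_ncard_le hsub
      ((Set.ncard_image_le ((hff x).image _)).trans (hmin _ n hg)) (((hff x).image _).image _)
    have hmem : u + h ∈ T.F^[n] '' T.fiber L (x + N • v - n • v + h) := heq ▸ ⟨u, hu, rfl⟩
    obtain ⟨y, hy, hye⟩ := hmem
    exact hye ▸ T.iterate_mem_OmSeq hy.1 n
  set h₀ := z - l - (x + N • v) with hh₀
  have hh₀r : h₀ ∈ Metric.ball 0 r := by simpa [dist_eq_norm, hh₀] using hzl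
  have hu := hsheet h₀ hh₀r z hz (by
    convert hl using 1
    rw [hh₀]
    abel)
  have hdense : Dense {h | T.Generic L v (x + N • v - n • v + h)} :=
    Measure.dense_of_ae (T.ae_generic _)
  refine (T.isClosed_OmSeq n).closure_subset (mem_closure_iff.2 fun V hV hzV => ?_)
  obtain ⟨h, ⟨hhr, hhV⟩, hg⟩ := hdense.inter_open_nonempty
    (Metric.ball 0 r ∩ (fun h => z - h₀ + h) ⁻¹' V)
    (Metric.isOpen_ball.inter (hV.preimage (by fun_prop))) ⟨h₀, hh₀r, by simpa using hzV⟩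
  exact ⟨_, hhV, hgen h hhr hg _ hu⟩

/-- A piecewise translation that projects to a minimal rotation modulo a
discrete group is of finite type. -/
lemma exists_OmSeq_succ_eq [Countable L]
    (hfin : ∀ s : Set (Fin d → ℝ), Bornology.IsBounded s → (s ∩ (L : Set (Fin d → ℝ))).Finite)
    (hv : ∀ i, T.v i - v ∈ L)
    (hmin : ∀ (W : Set (Fin d → ℝ)), IsOpen W → W.Nonempty →
      ∀ x, ∃ i : ℕ, ∃ l ∈ L, x - i • v - l ∈ W) :
    ∃ n : ℕ, T.OmSeq (n + 1) = T.OmSeq n := by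
  obtain ⟨N, c, r, hr, hN⟩ := T.exists_ball_OmSeq_subset hfin hv
  set O : ℕ → Set (Fin d → ℝ) := fun i => {z | ∃ l ∈ L, z - i • v - l ∈ Metric.ball c r} with hO
  have hOo : ∀ i, IsOpen (O i) := by
    intro i
    have : O i = ⋃ l ∈ L, (fun z => z - i • v - l) ⁻¹' Metric.ball c r := by
      ext z
      simp [hO]
    rw [this]
    exact isOpen_biUnion fun l _ => Metric.isOpen_ball.preimage (by fun_prop)
  have hOF : ∀ i y, T.F y ∈ O (i + 1) → y ∈ O i := by
    rintro i y ⟨l, hl, hlb⟩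
    refine ⟨l - (T.F y - (y + v)), L.sub_mem hl (T.F_sub_mem hv y), ?_⟩
    convert hlb using 1
    rw [succ_nsmul]
    abel
  have hstab : ∀ i n, N ≤ n → T.OmSeq (n + i) ∩ O i ⊆ T.OmSeq (n + i + 1) := by
    intro i
    induction i with
    | zero =>
      rintro n hn z ⟨hz, hzO⟩
      exact hN _ (by lia) ⟨T.OmSeq_antitone (by lia) hz, by simpa [hO] using hzO⟩
    | succ i ih =>
      exact fun n hn => T.OmSeq_inter_subset_succ (hOo _) (hOF i) (ih n hn)
  obtain ⟨t, ht⟩ := T.compact_Om.elim_finite_subcover O hOo fun x _ =>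
    mem_iUnion.2 (hmin _ Metric.isOpen_ball ⟨c, Metric.mem_ball_self hr⟩ x)
  refine ⟨N + t.sup id, (T.OmSeq_antitone (Nat.le_succ _)).antisymm fun z hz => ?_⟩
  obtain ⟨i, hi, hzi⟩ := mem_iUnion₂.1 (ht (T.OmSeq_antitone (Nat.zero_le _) hz))
  have hle : i ≤ t.sup id := Finset.le_sup (f := id) hi
  have := hstab i (N + t.sup id - i) (by lia)
  rw [show N + t.sup id - i + i = N + t.sup id by lia] at this
  exact this ⟨hz, hzi⟩

end

section

variable {d : ℕ} (T : PWT d (d + 1))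

lemma isUnit_det_latMatrix
    (hrank : LinearIndependent ℝ (fun i : Fin d => T.v i.succ - T.v 0)) :
    IsUnit T.latMatrix.det := by
  rw [← Matrix.isUnit_iff_isUnit_det, ← Matrix.linearIndependent_cols_iff_isUnit]
  exact hrank

lemma torusProj_add (x y : Fin d → ℝ) : T.torusProj (x + y) = T.torusProj x + T.torusProj y := by
  ext i
  simp [torusProj, Matrix.mulVec_add]

lemma torusProj_nsmul (n : ℕ) (x : Fin d → ℝ) : T.torusProj (n • x) = n • T.torusProj x := by
  induction n with
  | zero =>
    ext i
    simp [torusProj]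
  | succ n ih => rw [succ_nsmul, succ_nsmul, torusProj_add, ih]

lemma isOpenMap_torusProj
    (hrank : LinearIndependent ℝ (fun i : Fin d => T.v i.succ - T.v 0)) :
    IsOpenMap T.torusProj := by
  have h1 : IsOpenMap (Pi.map fun (_ : Fin d) (x : ℝ) => (x : AddCircle (1 : ℝ))) :=
    IsOpenMap.piMap (fun _ => QuotientAddGroup.isOpenMap_coe)
      (.of_forall fun _ => QuotientAddGroup.mk_surjective)
  have hsurj : Function.Surjective (T.latMatrix⁻¹.mulVecLin) := fun y =>
    ⟨T.latMatrix.mulVec y, by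
      simp [Matrix.nonsing_inv_mul _ (T.isUnit_det_latMatrix hrank)]⟩
  have h2 : IsOpenMap (T.latMatrix⁻¹.mulVecLin) :=
    (LinearMap.toContinuousLinearMap T.latMatrix⁻¹.mulVecLin).isOpenMap hsurj
  exact h1.comp h2

lemma sub_mem_span_of_torusProj_eq
    (hrank : LinearIndependent ℝ (fun i : Fin d => T.v i.succ - T.v 0)) {x y : Fin d → ℝ}
    (h : T.torusProj x = T.torusProj y) :
    x - y ∈ Submodule.span ℤ (range fun i : Fin d => T.v i.succ - T.v 0) := by
  have hint : ∀ i, ∃ c : ℤ, (c : ℝ) = (T.latMatrix⁻¹.mulVec (x - y)) i := by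
    intro i
    have hi : ((T.latMatrix⁻¹.mulVec x i : ℝ) : AddCircle (1 : ℝ)) =
        (T.latMatrix⁻¹.mulVec y i : ℝ) := congrFun h i
    rw [← sub_eq_zero, ← AddCircle.coe_sub, AddCircle.coe_eq_zero_iff] at hi
    obtain ⟨c, hc⟩ := hi
    exact ⟨c, by simpa [Matrix.mulVec_sub] using hc⟩
  choose c hc using hint
  have hxy : x - y = ∑ j, c j • (T.v j.succ - T.v 0) := by
    have h1 : x - y = T.latMatrix.mulVec (T.latMatrix⁻¹.mulVec (x - y)) := by
      simp [Matrix.mul_nonsing_inv _ (T.isUnit_det_latMatrix hrank)]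
    rw [h1]
    ext i
    simp only [Matrix.mulVec, dotProduct, Finset.sum_apply, Pi.smul_apply] at hc ⊢
    refine Finset.sum_congr rfl fun j _ => ?_
    rw [← hc j]
    simp [latMatrix, mul_comm]
  rw [hxy]
  exact Submodule.sum_mem _ fun j _ =>
    Submodule.smul_mem _ _ (Submodule.subset_span (mem_range_self j))

end

end PWT

/-- A piecewise translation of `m = d+1` branches in `ℝ^d` whose translation
vectors have rank `d` and whose torus rotation factor `R(φ) = φ + π(v_0)` is ergodic
(w.r.t. Haar measure on `T = ℝ^d/L`) is of finite type: `Ω_{n+1} = Ω_n` for some `n`. -/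
theorem pwt_finite_type {d : ℕ} (T : PWT d (d + 1))
    (hrank : LinearIndependent ℝ (fun i : Fin d => T.v i.succ - T.v 0))
    (herg : Ergodic (fun φ : Fin d → AddCircle (1 : ℝ) => φ + T.torusProj (T.v 0)) volume) :
    ∃ n : ℕ, T.OmSeq (n + 1) = T.OmSeq n := by
  let b := basisOfLinearIndependentOfCardEqFinrank' _ hrank (by simp)
  have hb : (b : Fin d → Fin d → ℝ) = fun i : Fin d => T.v i.succ - T.v 0 :=
    coe_basisOfLinearIndependentOfCardEqFinrank' _ hrank (by simp)
  let L := (Submodule.span ℤ (range b)).toAddSubgroup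
  have : Countable L := inferInstanceAs (Countable (Submodule.span ℤ (range b)))
  refine T.exists_OmSeq_succ_eq (L := L) (v := T.v 0)
    (fun s hs => ZSpan.setFinite_inter b hs) (fun i => ?_) fun W hW hWne x => ?_
  · refine Fin.cases ?_ (fun j => ?_) i
    · simp
    · exact Submodule.subset_span (hb ▸ mem_range_self j)
  · simp only [add_comm _ (T.torusProj (T.v 0))] at herg
    have hdense : DenseRange fun n : ℕ => n • T.torusProj (T.v 0) :=
      denseRange_zsmul_iff_nsmul.1 (DenseRange.zsmul_of_ergodic_add_left herg)
    obtain ⟨n, w, hwW, hw⟩ := hdense.exists_mem_open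
      ((T.isOpenMap_torusProj hrank W hW).preimage
        (f := fun y => T.torusProj x - y) (by fun_prop))
      (by
        obtain ⟨w, hw⟩ := hWne
        exact ⟨T.torusProj x - T.torusProj w, w, hw, by simp⟩)
    refine ⟨n, x - (w + n • T.v 0), ?_, by convert hwW using 1; abel⟩
    have hmem := T.sub_mem_span_of_torusProj_eq hrank (x := x) (y := w + n • T.v 0) (by
      rw [T.torusProj_add, T.torusProj_nsmul, hw, sub_add_cancel])
    rwa [← hb] at hmem
end

section
/- Let T_1(y) = y + α (mod 1) be the rotation of the circle S = ℝ/ℤ and T_2 = T_{α,β,δ} the double rotation, with α, β irrational, 0 < β < min(δ, 1 − δ), and δ ∈ (0,1). Then for every arc K ⊆ S with length |K| < β there exists a finite itinerary J = (j_1, …, j_k) ∈ {1,2}^k such that T_J(K) is contained in an arc of length at most (3/4)·|K|. -/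
open MeasureTheory Topology Filter Set

/-- The rigid rotation `T₁(y) = y + α (mod 1)` of the circle `S = ℝ/ℤ`. -/
noncomputable def rigidRot (a : ℝ) : AddCircle (1 : ℝ) → AddCircle (1 : ℝ) :=
  fun y => y + (a : AddCircle (1 : ℝ))

/-- The double rotation `T_{α,β,δ}` of the circle `S = ℝ/ℤ`:
`x ↦ x + α + β (mod 1)` if `x ≤ δ` and `x ↦ x + α (mod 1)` if `x > δ`,
where `x` is identified with its representative in `[0,1)`. -/
noncomputable def doubleRot (a b dl : ℝ) : AddCircle (1 : ℝ) → AddCircle (1 : ℝ) :=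
  fun x =>
    if ((AddCircle.equivIco 1 0 x : ℝ)) ≤ dl then x + ((a + b : ℝ) : AddCircle (1 : ℝ))
    else x + (a : AddCircle (1 : ℝ))

/-- `T_J = T_{j_1} ∘ … ∘ T_{j_k}` for a finite itinerary `J = (j_1, …, j_k)` in `{1,2}^k`;
here the letter `true` stands for the rigid rotation `T₁` and `false` for the double
rotation `T₂ = T_{α,β,δ}`. -/
noncomputable def applyWord (a b dl : ℝ) : List Bool → AddCircle (1 : ℝ) → AddCircle (1 : ℝ)
  | [] => id
  | j :: J => (cond j (rigidRot a) (doubleRot a b dl)) ∘ applyWord a b dl J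


/-- Some finite word in the two maps sends `X` into `Y`. -/
def Reaches (a b dl : ℝ) (X Y : Set (AddCircle (1 : ℝ))) : Prop :=
  ∃ J : List Bool, MapsTo (applyWord a b dl J) X Y

/-- The image in the circle of the interval `[x, y]`. -/
def circArc (x y : ℝ) : Set (AddCircle (1 : ℝ)) :=
  (fun z : ℝ => (z : AddCircle (1 : ℝ))) '' Icc x y

/-- An arc of length `u` ending at `x`, together with an arc of length `v` starting at `x + d`. -/
def twoArcs (x d u v : ℝ) : Set (AddCircle (1 : ℝ)) :=
  circArc (x - u) x ∪ circArc (x + d) (x + d + v)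

theorem applyWord_append (a b dl : ℝ) (J L : List Bool) (x : AddCircle (1 : ℝ)) :
    applyWord a b dl (J ++ L) x = applyWord a b dl J (applyWord a b dl L x) := by
  induction J with
  | nil => rfl
  | cons j J ih => simp [applyWord, ih]

section Reaches

variable {a b dl : ℝ} {X Y Z : Set (AddCircle (1 : ℝ))}

theorem Reaches.of_subset (h : X ⊆ Y) : Reaches a b dl X Y := ⟨[], h⟩

theorem Reaches.trans (h : Reaches a b dl X Y) (h' : Reaches a b dl Y Z) :
    Reaches a b dl X Z := by
  obtain ⟨J, hJ⟩ := h
  obtain ⟨L, hL⟩ := h'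
  refine ⟨L ++ J, fun x hx => ?_⟩
  rw [applyWord_append]
  exact hL (hJ hx)

end Reaches

theorem coe_add_intCast (x : ℝ) (k : ℤ) :
    ((x + k : ℝ) : AddCircle (1 : ℝ)) = (x : AddCircle (1 : ℝ)) := by
  have : ((k : ℝ) : AddCircle (1 : ℝ)) = 0 := (AddCircle.coe_eq_zero_iff 1).2 ⟨k, by simp⟩
  rw [AddCircle.coe_add, this, add_zero]

theorem coe_mem_circArc {x y z : ℝ} (h₁ : x ≤ z) (h₂ : z ≤ y) :
    (z : AddCircle (1 : ℝ)) ∈ circArc x y := ⟨z, ⟨h₁, h₂⟩, rfl⟩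

theorem circArc_mono {x y x' y' : ℝ} (h₁ : x' ≤ x) (h₂ : y ≤ y') :
    circArc x y ⊆ circArc x' y' := image_mono (Icc_subset_Icc h₁ h₂)

theorem circArc_add_int_subset (x y : ℝ) (k : ℤ) : circArc (x + k) (y + k) ⊆ circArc x y := by
  rintro _ ⟨z, ⟨h₁, h₂⟩, rfl⟩
  refine ⟨z - k, ⟨by linarith, by linarith⟩, ?_⟩
  simp [← coe_add_intCast (z - k) k]

theorem twoArcs_add_int_subset (x d u v : ℝ) (k : ℤ) :
    twoArcs x (d + k) u v ⊆ twoArcs x d u v := by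
  refine union_subset_union_right _ ?_
  have := circArc_add_int_subset (x + d) (x + d + v) k
  convert this using 2 <;> ring

theorem exists_nat_mul_add_int_mem_Ioo {a : ℝ} (ha : Irrational a) {x y : ℝ} (h : x < y) :
    ∃ (k : ℕ) (j : ℤ), (k * a + j : ℝ) ∈ Ioo x y := by
  have hd : DenseRange (· • (a : AddCircle (1 : ℝ)) : ℕ → AddCircle (1 : ℝ)) := by
    rw [← denseRange_zsmul_iff_nsmul, AddCircle.denseRange_zsmul_coe_iff]
    simpa using ha
  have ho : IsOpen ((fun z : ℝ => (z : AddCircle (1 : ℝ))) '' Ioo x y) :=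
    QuotientAddGroup.isOpenMap_coe _ isOpen_Ioo
  obtain ⟨k, z, hz, hk⟩ := hd.exists_mem_open ho ((nonempty_Ioo.2 h).image _)
  have hk' : ((z - k * a : ℝ) : AddCircle (1 : ℝ)) = 0 := by
    rw [AddCircle.coe_sub, sub_eq_zero, ← nsmul_eq_mul]
    exact hk
  obtain ⟨j, hj⟩ := (AddCircle.coe_eq_zero_iff 1).1 hk'
  have hz' : (k * a + j : ℝ) = z := by
    rw [zsmul_one] at hj
    linarith
  exact ⟨k, j, hz' ▸ hz⟩

theorem exists_word_rotation {a : ℝ} (ha : Irrational a) (b dl p : ℝ) {x y : ℝ} (h : x < y) :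
    ∃ (J : List Bool) (t : ℝ), p + t ∈ Ioo x y ∧
      ∀ w : ℝ, applyWord a b dl J (w : AddCircle (1 : ℝ)) = ((w + t : ℝ) : AddCircle (1 : ℝ)) := by
  obtain ⟨k, j, hk⟩ := exists_nat_mul_add_int_mem_Ioo ha (sub_lt_sub_right h p)
  refine ⟨List.replicate k true, k * a + j, ⟨by linarith [hk.1], by linarith [hk.2]⟩, fun w => ?_⟩
  rw [← add_assoc, coe_add_intCast]
  clear hk
  induction k with
  | zero => simp [applyWord]
  | succ k ih =>
    simp only [List.replicate_succ, applyWord, Function.comp_apply, ih, cond_true, rigidRot]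
    rw [← AddCircle.coe_add]
    congr 1
    push_cast
    ring

theorem doubleRot_of_le {a b dl z : ℝ} (h₀ : 0 ≤ z) (h₁ : z ≤ dl) (hd1 : dl < 1) :
    doubleRot a b dl (z : AddCircle (1 : ℝ)) = ((z + a + b : ℝ) : AddCircle (1 : ℝ)) := by
  have : ((AddCircle.equivIco 1 0 (z : AddCircle (1 : ℝ)) : ℝ)) = z :=
    AddCircle.equivIco_coe_of_mem ⟨h₀, by linarith⟩
  rw [doubleRot, this, if_pos h₁, ← AddCircle.coe_add, add_assoc]

theorem doubleRot_of_gt {a b dl z : ℝ} (h₀ : dl < z) (h₁ : z < 1) (hd0 : 0 < dl) :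
    doubleRot a b dl (z : AddCircle (1 : ℝ)) = ((z + a : ℝ) : AddCircle (1 : ℝ)) := by
  have : ((AddCircle.equivIco 1 0 (z : AddCircle (1 : ℝ)) : ℝ)) = z :=
    AddCircle.equivIco_coe_of_mem ⟨by linarith, by linarith⟩
  rw [doubleRot, this, if_neg h₀.not_ge, ← AddCircle.coe_add]

theorem doubleRot_of_neg {a b dl z : ℝ} (h₀ : dl - 1 < z) (h₁ : z < 0) (hd0 : 0 < dl) :
    doubleRot a b dl (z : AddCircle (1 : ℝ)) = ((z + a : ℝ) : AddCircle (1 : ℝ)) := by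
  have h := coe_add_intCast z 1
  have h' := coe_add_intCast (z + a) 1
  push_cast at h h'
  rw [← h, doubleRot_of_gt (by linarith) (by linarith) hd0, ← h']
  congr 1
  ring

theorem Reaches.of_rotation_doubleRot {a b dl t : ℝ} {J : List Bool}
    (hJ : ∀ w : ℝ, applyWord a b dl J (w : AddCircle (1 : ℝ)) = ((w + t : ℝ) : AddCircle (1 : ℝ)))
    {X : Set ℝ} {Y : Set (AddCircle (1 : ℝ))}
    (h : ∀ w ∈ X, doubleRot a b dl ((w + t : ℝ) : AddCircle (1 : ℝ)) ∈ Y) :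
    Reaches a b dl ((fun z : ℝ => (z : AddCircle (1 : ℝ))) '' X) Y := by
  refine ⟨false :: J, ?_⟩
  rintro _ ⟨w, hw, rfl⟩
  simpa [applyWord, hJ] using h w hw

section Steps

variable {a b dl : ℝ}

/-- Cutting an arc near its midpoint at the discontinuity `0`. -/
theorem reaches_twoArcs_of_arc (ha : Irrational a) (hd0 : 0 < dl) (hd1 : dl < 1) {l : ℝ}
    (hl : 0 < l) (hl1 : l < dl) (hl2 : l < 1 - dl) (p : ℝ) :
    ∃ x u v : ℝ, u + v = l ∧ 3 / 8 * l ≤ u ∧ u ≤ 5 / 8 * l ∧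
      Reaches a b dl (circArc p (p + l)) (twoArcs x b u v) := by
  obtain ⟨J, t, ⟨ht1, ht2⟩, hJ⟩ := exists_word_rotation ha b dl (p + l / 2)
    (show -(l / 8) < l / 8 by linarith)
  refine ⟨a, -(p + t), p + l + t, by ring, by linarith, by linarith, ?_⟩
  refine Reaches.of_rotation_doubleRot hJ fun w hw => ?_
  obtain ⟨hw1, hw2⟩ := hw
  rcases lt_or_ge (w + t) 0 with h | h
  · rw [doubleRot_of_neg (by linarith) h hd0]
    exact Or.inl (coe_mem_circArc (by linarith) (by linarith))
  · rw [doubleRot_of_le h (by linarith) hd1]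
    exact Or.inr (coe_mem_circArc (by linarith) (by linarith))

/-- Cutting an arc near its midpoint at the discontinuity `dl`. -/
theorem reaches_twoArcs_swap_of_arc (ha : Irrational a) (hd0 : 0 < dl) (hd1 : dl < 1) {l : ℝ}
    (hl : 0 < l) (hl1 : l < dl) (hl2 : l < 1 - dl) (p : ℝ) :
    ∃ x u v : ℝ, u + v = l ∧ 3 / 8 * l ≤ u ∧ u ≤ 5 / 8 * l ∧
      Reaches a b dl (circArc p (p + l)) (twoArcs x (b - l) u v) := by
  obtain ⟨J, t, ⟨ht1, ht2⟩, hJ⟩ := exists_word_rotation ha b dl (p + l / 2)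
    (show dl - l / 8 < dl + l / 8 by linarith)
  refine ⟨p + l + t + a, p + l + t - dl, dl - (p + t), by ring, by linarith, by linarith, ?_⟩
  refine Reaches.of_rotation_doubleRot hJ fun w hw => ?_
  obtain ⟨hw1, hw2⟩ := hw
  rcases lt_or_ge dl (w + t) with h | h
  · rw [doubleRot_of_gt h (by linarith) hd0]
    exact Or.inl (coe_mem_circArc (by linarith) (by linarith))
  · rw [doubleRot_of_le (by linarith) h hd1]
    exact Or.inr (coe_mem_circArc (by linarith) (by linarith))

/-- Two arcs separated by gaps on both sides can be moved further apart by `b`. -/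
theorem reaches_twoArcs_add (ha : Irrational a) (hd0 : 0 < dl) (hd1 : dl < 1) {x d u v : ℝ}
    (hd : 0 < d) (hu : u < 1 - dl) (hv : v < dl) (h : d + u + v < 1) :
    ∃ x' : ℝ, Reaches a b dl (twoArcs x d u v) (twoArcs x' (d + b) u v) := by
  obtain ⟨J, t, ⟨ht1, ht2⟩, hJ⟩ := exists_word_rotation ha b dl x
    (show max (-d) (dl - 1 + u) < min 0 (dl - d - v) by
      rw [max_lt_iff, lt_min_iff, lt_min_iff]
      refine ⟨⟨?_, ?_⟩, ?_, ?_⟩ <;> linarith)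
  rw [max_lt_iff] at ht1
  rw [lt_min_iff] at ht2
  refine ⟨x + t + a, ?_⟩
  rw [twoArcs, circArc, circArc, ← image_union]
  refine Reaches.of_rotation_doubleRot hJ ?_
  rintro w (⟨hw1, hw2⟩ | ⟨hw1, hw2⟩)
  · rw [doubleRot_of_neg (by linarith) (by linarith) hd0]
    exact Or.inl (coe_mem_circArc (by linarith) (by linarith))
  · rw [doubleRot_of_le (by linarith) (by linarith) hd1]
    exact Or.inr (coe_mem_circArc (by linarith) (by linarith))

theorem fract_nat_mul_pos (hb : Irrational b) {m : ℕ} (hm : 1 ≤ m) : 0 < Int.fract (m * b) :=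
  Int.fract_pos.2 ((hb.natCast_mul (by omega)).ne_int _)

theorem reaches_twoArcs_nat_mul (ha : Irrational a) (hb : Irrational b) (hd0 : 0 < dl)
    (hd1 : dl < 1) {l : ℝ} (hl : 0 < l) (hl1 : l < dl) (hl2 : l < 1 - dl) (p : ℝ) (n : ℕ)
    (hn : ∀ j : ℕ, 1 ≤ j → j ≤ n → l ≤ 1 - Int.fract (j * b)) :
    ∃ x u v : ℝ, u + v = l ∧ 3 / 8 * l ≤ u ∧ u ≤ 5 / 8 * l ∧
      Reaches a b dl (circArc p (p + l)) (twoArcs x ((n + 1 : ℕ) * b) u v) := by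
  induction n with
  | zero => simpa using reaches_twoArcs_of_arc ha hd0 hd1 hl hl1 hl2 p
  | succ n ih =>
    obtain ⟨x, u, v, huv, hu1, hu2, hr⟩ := ih fun j hj hjn => hn j hj (by omega)
    have hf := hn (n + 1) (by omega) le_rfl
    have hf0 : 0 < Int.fract (((n + 1 : ℕ) : ℝ) * b) := fract_nat_mul_pos hb (by omega)
    have hfl := Int.floor_add_fract (((n + 1 : ℕ) : ℝ) * b)
    set f := Int.fract (((n + 1 : ℕ) : ℝ) * b)
    set k := ⌊((n + 1 : ℕ) : ℝ) * b⌋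
    have hr' : Reaches a b dl (circArc p (p + l)) (twoArcs x f u v) := by
      refine hr.trans (Reaches.of_subset ?_)
      rw [← hfl, add_comm]
      exact twoArcs_add_int_subset _ _ _ _ _
    have hnext : ((n + 1 + 1 : ℕ) : ℝ) * b = f + b + k := by
      push_cast at hfl ⊢
      linarith
    rcases hf.lt_or_eq with hlt | heq
    · obtain ⟨x', hx'⟩ := reaches_twoArcs_add (a := a) (b := b) ha hd0 hd1 (x := x) (u := u)
        (v := v) hf0 (by linarith) (by linarith) (by linarith)
      refine ⟨x', u, v, huv, hu1, hu2, hr'.trans (hx'.trans (Reaches.of_subset ?_))⟩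
      have := twoArcs_add_int_subset x' (((n + 1 + 1 : ℕ) : ℝ) * b) u v (-k)
      rw [hnext] at this ⊢
      simpa using this
    · obtain ⟨x', u', v', huv', hu1', hu2', hx'⟩ :=
        reaches_twoArcs_swap_of_arc (b := b) ha hd0 hd1 hl hl1 hl2 (x - l)
      refine ⟨x', u', v', huv', hu1', hu2',
        hr'.trans ((Reaches.of_subset ?_).trans (hx'.trans (Reaches.of_subset ?_)))⟩
      · refine union_subset (circArc_mono (by linarith) (by linarith)) ?_
        refine Subset.trans (Eq.subset ?_) ((circArc_add_int_subset (x + f - 1) (x + f + v - 1)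
          1).trans (circArc_mono (by linarith) (by linarith)))
        congr 1 <;> push_cast <;> ring
      · have := twoArcs_add_int_subset x' (((n + 1 + 1 : ℕ) : ℝ) * b) u' v' (-(k + 1))
        rw [hnext] at this ⊢
        convert this using 2
        push_cast
        linarith

theorem reaches_shorter_arc (ha : Irrational a) (hb : Irrational b) (hd0 : 0 < dl)
    (hd1 : dl < 1) {l : ℝ} (hl : 0 < l) (hl1 : l < dl) (hl2 : l < 1 - dl) (p : ℝ) (n : ℕ)
    (hn : ∀ j : ℕ, 1 ≤ j → j ≤ n → l ≤ 1 - Int.fract (j * b)) {s : ℝ}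
    (hs : s = 1 - Int.fract ((n + 1 : ℕ) * b)) (hsl : s < l) :
    ∃ p' : ℝ, Reaches a b dl (circArc p (p + l)) (circArc p' (p' + max s (l - s / 2))) := by
  obtain ⟨x, u, v, huv, hu1, hu2, hr⟩ := reaches_twoArcs_nat_mul ha hb hd0 hd1 hl hl1 hl2 p n hn
  have hfl := Int.floor_add_fract (((n + 1 : ℕ) : ℝ) * b)
  have hs0 : 0 < s := by linarith [Int.fract_lt_one (((n + 1 : ℕ) : ℝ) * b)]
  have hsub : twoArcs x ((n + 1 : ℕ) * b) u v ⊆ twoArcs x (-s) u v := by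
    have := twoArcs_add_int_subset x (-s) u v (⌊((n + 1 : ℕ) : ℝ) * b⌋ + 1)
    convert this using 2
    push_cast at hfl hs ⊢
    linarith
  refine ⟨x - max u s, hr.trans (Reaches.of_subset (hsub.trans (union_subset ?_ ?_)))⟩
  · refine circArc_mono (by linarith [le_max_left u s]) ?_
    rcases max_cases u s with h | h <;> rcases max_cases s (l - s / 2) with h' | h' <;> linarith
  · refine circArc_mono (by linarith [le_max_right u s]) ?_
    rcases max_cases u s with h | h <;> rcases max_cases s (l - s / 2) with h' | h' <;> linarith

theorem reaches_arc_le_of_first_return (ha : Irrational a) (hb : Irrational b) (hd0 : 0 < dl)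
    (hd1 : dl < 1) (n : ℕ) {s : ℝ} (hs : s = 1 - Int.fract ((n + 1 : ℕ) * b)) (k : ℕ) :
    ∀ l : ℝ, 0 < l → l < dl → l < 1 - dl →
      (∀ j : ℕ, 1 ≤ j → j ≤ n → l ≤ 1 - Int.fract (j * b)) → l ≤ s + k * (s / 2) → ∀ p : ℝ,
      ∃ l' p' : ℝ, 0 < l' ∧ l' ≤ l ∧ l' ≤ s ∧
        Reaches a b dl (circArc p (p + l)) (circArc p' (p' + l')) := by
  have hs0 : 0 < s := by linarith [Int.fract_lt_one (((n + 1 : ℕ) : ℝ) * b)]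
  induction k with
  | zero =>
    intro l hl _ _ _ hle p
    exact ⟨l, p, hl, le_rfl, by simpa using hle, Reaches.of_subset subset_rfl⟩
  | succ k ih =>
    intro l hl hl1 hl2 hn hle p
    rcases le_or_gt l s with hls | hls
    · exact ⟨l, p, hl, le_rfl, hls, Reaches.of_subset subset_rfl⟩
    · obtain ⟨p₁, hp₁⟩ := reaches_shorter_arc ha hb hd0 hd1 hl hl1 hl2 p n hn hs hls
      have hk : 0 ≤ k * (s / 2) := by positivity
      have hm : max s (l - s / 2) ≤ l := max_le hls.le (by linarith)
      obtain ⟨l', p', h0, h1, h2, h3⟩ := ih (max s (l - s / 2)) (lt_max_of_lt_left hs0)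
        (by linarith) (by linarith) (fun j hj hjn => hm.trans (hn j hj hjn))
        (max_le (by linarith) (by push_cast at hle; linarith)) p₁
      exact ⟨l', p', h0, h1.trans hm, h2, hp₁.trans h3⟩

theorem reaches_arc_le (ha : Irrational a) (hb : Irrational b) (hd0 : 0 < dl) (hd1 : dl < 1)
    {l : ℝ} (hl : 0 < l) (hl1 : l < dl) (hl2 : l < 1 - dl) (p : ℝ) (n : ℕ) :
    ∃ l' p' : ℝ, 0 < l' ∧ l' ≤ l ∧ (∀ j : ℕ, 1 ≤ j → j ≤ n → l' ≤ 1 - Int.fract (j * b)) ∧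
      Reaches a b dl (circArc p (p + l)) (circArc p' (p' + l')) := by
  induction n with
  | zero => exact ⟨l, p, hl, le_rfl, fun j h h' => by omega, Reaches.of_subset subset_rfl⟩
  | succ n ih =>
    obtain ⟨l₁, p₁, h0, h1, hj, hr⟩ := ih
    have hs0 : 0 < 1 - Int.fract (((n + 1 : ℕ) : ℝ) * b) := by
      linarith [Int.fract_lt_one (((n + 1 : ℕ) : ℝ) * b)]
    obtain ⟨k, hk⟩ := exists_nat_ge (l₁ / ((1 - Int.fract (((n + 1 : ℕ) : ℝ) * b)) / 2))
    rw [div_le_iff₀ (by linarith)] at hk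
    obtain ⟨l₂, p₂, h0', h1', hs, hr'⟩ := reaches_arc_le_of_first_return ha hb hd0 hd1 n rfl k l₁ h0
      (by linarith) (by linarith) hj (by linarith) p₁
    refine ⟨l₂, p₂, h0', h1'.trans h1, fun j hj1 hjn => ?_, hr.trans hr'⟩
    rcases hjn.lt_or_eq with h | rfl
    · exact h1'.trans (hj j hj1 (by omega))
    · exact hs

theorem exists_one_sub_fract_le (hb : Irrational b) {e : ℝ} (he0 : 0 < e) (he1 : e < 1) :
    ∃ n : ℕ, 1 ≤ n ∧ 1 - Int.fract (n * b) ≤ e := by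
  obtain ⟨k, j, h1, h2⟩ := exists_nat_mul_add_int_mem_Ioo hb (show 1 - e < 1 by linarith)
  have hf : Int.fract (k * b) = k * b + j := by
    rw [← Int.fract_add_intCast, Int.fract_eq_self]
    exact ⟨by linarith, h2⟩
  refine ⟨k, Nat.one_le_iff_ne_zero.2 ?_, by linarith⟩
  rintro rfl
  simp at hf h1
  linarith

end Steps

theorem isCompact_circArc (x y : ℝ) : IsCompact (circArc x y) :=
  isCompact_Icc.image (AddCircle.continuous_mk' 1)

theorem isConnected_circArc {x y : ℝ} (h : x ≤ y) : IsConnected (circArc x y) :=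
  (isConnected_Icc h).image _ (AddCircle.continuous_mk' 1).continuousOn

theorem volume_circArc_le (x l : ℝ) : volume (circArc x (x + l)) ≤ ENNReal.ofReal l := by
  have hsub : circArc x (x + l) ⊆
      Metric.closedBall ((x + l / 2 : ℝ) : AddCircle (1 : ℝ)) (l / 2) := by
    rintro _ ⟨z, ⟨h1, h2⟩, rfl⟩
    rw [mem_closedBall_iff_norm, ← AddCircle.coe_sub]
    refine (QuotientAddGroup.norm_mk_le_norm).trans ?_
    rw [Real.norm_eq_abs, abs_le]
    constructor <;> linarith
  refine (measure_mono hsub).trans ?_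
  rw [AddCircle.volume_closedBall]
  exact ENNReal.ofReal_le_ofReal ((min_le_right _ _).trans (by linarith))

/-- A proper closed connected subset of the circle is the image of an interval. -/
theorem exists_eq_circArc {K : Set (AddCircle (1 : ℝ))} (hc : IsClosed K) (hK : IsConnected K)
    (hne : K ≠ univ) :
    ∃ p l : ℝ, 0 ≤ l ∧ K = circArc p (p + l) ∧ ENNReal.ofReal l ≤ volume K := by
  obtain ⟨c, hcK⟩ := (ne_univ_iff_exists_notMem K).1 hne
  obtain ⟨c, rfl⟩ := QuotientAddGroup.mk_surjective c
  let e := AddCircle.openPartialHomeomorphCoe (1 : ℝ) c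
  have hKt : K ⊆ e.target := fun x hx hxc => hcK (by rwa [← mem_singleton_iff.1 hxc])
  have hcont : ContinuousOn e.symm K := e.continuousOn_symm.mono hKt
  have hIcc := eq_Icc_of_connected_compact (hK.image _ hcont)
    (hc.isCompact.image_of_continuousOn hcont)
  have hsub : e.symm '' K ⊆ Ioo c (c + 1) := by
    rintro _ ⟨x, hx, rfl⟩
    exact e.map_target (hKt hx)
  have hKe : K = e '' (e.symm '' K) := by
    rw [image_image]
    exact ((image_congr fun x hx => e.right_inv (hKt hx)).trans (image_id K)).symm
  have hle : sInf (e.symm '' K) ≤ sSup (e.symm '' K) :=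
    nonempty_Icc.1 (hIcc ▸ hK.nonempty.image _)
  set q := sInf (e.symm '' K)
  set r := sSup (e.symm '' K)
  have hKeq : K = circArc q (q + (r - q)) := by
    rw [hKe, hIcc, add_sub_cancel]
    rfl
  refine ⟨q, r - q, sub_nonneg.2 hle, hKeq, ?_⟩
  rw [AddCircle.add_projection_respects_measure 1 c hc.measurableSet, ← Real.volume_Icc]
  refine measure_mono fun z hz => ⟨?_, Ioo_subset_Ioc_self (hsub (hIcc ▸ hz))⟩
  rw [mem_preimage, hKeq]
  exact coe_mem_circArc hz.1 (by linarith [hz.2])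

/-- For the rigid rotation `T₁(y) = y + α` and the double rotation
`T₂ = T_{α,β,δ}` with `α, β` irrational, `0 < β < min(δ, 1-δ)`, `δ ∈ (0,1)`: every arc
`K` (a closed connected subset of `S`) of length `|K| < β` admits a finite itinerary `J`
such that `T_J(K)` is contained in an arc of length at most `(3/4)·|K|`. -/
theorem circle_word_contracts_arc (a b dl : ℝ) (ha : Irrational a) (ha0 : 0 < a) (ha1 : a < 1)
    (hb : Irrational b) (hb0 : 0 < b) (hb1 : b < min dl (1 - dl))
    (hd0 : 0 < dl) (hd1 : dl < 1) :
    ∀ K : Set (AddCircle (1 : ℝ)), IsClosed K → IsConnected K →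
      volume K < ENNReal.ofReal b →
        ∃ J : List Bool, ∃ I : Set (AddCircle (1 : ℝ)),
          IsClosed I ∧ IsConnected I ∧ volume I ≤ (3 / 4 : ENNReal) * volume K ∧
            applyWord a b dl J '' K ⊆ I := by
  intro K hc hK hvol
  rw [lt_min_iff] at hb1
  have hne : K ≠ univ := by
    rintro rfl
    rw [AddCircle.measure_univ, ENNReal.ofReal_lt_ofReal_iff hb0] at hvol
    linarith [hb1.1]
  obtain ⟨p, l, hl0, rfl, hl⟩ := exists_eq_circArc hc hK hne
  have hlb : l < b := (ENNReal.ofReal_lt_ofReal_iff hb0).1 (hl.trans_lt hvol)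
  rcases hl0.eq_or_lt with rfl | hlpos
  · refine ⟨[], _, hc, hK, ?_, by simp [applyWord]⟩
    have h0 : volume (circArc p (p + 0)) = 0 := by simpa using volume_circArc_le p 0
    rw [h0]
    exact zero_le
  · obtain ⟨n, hn1, hn⟩ := exists_one_sub_fract_le hb (e := 3 / 4 * l) (by positivity)
      (by linarith [hb1.1])
    obtain ⟨l', p', hl'0, -, hl', J, hJ⟩ := reaches_arc_le (a := a) ha hb hd0 hd1 hlpos
      (hlb.trans hb1.1) (hlb.trans hb1.2) p n
    refine ⟨J, circArc p' (p' + l'), (isCompact_circArc _ _).isClosed,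
      isConnected_circArc (by linarith), ?_, hJ.image_subset⟩
    calc volume (circArc p' (p' + l')) ≤ ENNReal.ofReal l' := volume_circArc_le _ _
      _ ≤ ENNReal.ofReal (3 / 4 * l) := ENNReal.ofReal_le_ofReal ((hl' n hn1 le_rfl).trans hn)
      _ = 3 / 4 * ENNReal.ofReal l := by
        rw [ENNReal.ofReal_mul (by norm_num), ENNReal.ofReal_div_of_pos (by norm_num)]
        simp
      _ ≤ 3 / 4 * volume (circArc p (p + l)) := by gcongr
end
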